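/- Let O be a consistent LTL_krom^○ ontology without nested temporal operators. A data instance A is inconsistent with O if and only if (B, n) ⇝ (¬B', n') for some B(n), B'(n') ∈ A. -/

import Mathlib

namespace LTLOMQ

/-! ## Temporal concepts (LTL formulas) and their semantics over (ℤ,<) -/

/-- Temporal concepts: arbitrary LTL formulas over atomic concepts indexed by `ℕ`. -/
inductive TC : Type where
  | top : TC
  | atom : ℕ → TC
  | neg : TC → TC
  | and : TC → TC → TC
  | or : TC → TC → TC
  | nextF : TC → TC
  | diamF : TC → TC
  | boxF : TC → TC
  | untl : TC → TC → TC
  | nextP : TC → TC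
  | diamP : TC → TC
  | boxP : TC → TC
  | since : TC → TC → TC

/-- A temporal interpretation assigns to each atomic concept a subset of ℤ. -/
abbrev Itp : Type := ℕ → Set ℤ

/-- The extension of a temporal concept in an interpretation
(strict semantics over `(ℤ,<)`). -/
def TC.sem (M : Itp) : TC → Set ℤ
  | .top => Set.univ
  | .atom a => M a
  | .neg C => (TC.sem M C)ᶜ
  | .and C D => TC.sem M C ∩ TC.sem M D
  | .or C D => TC.sem M C ∪ TC.sem M D
  | .nextF C => {n | n + 1 ∈ TC.sem M C}
  | .diamF C => {n | ∃ k, n < k ∧ k ∈ TC.sem M C}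
  | .boxF C => {n | ∀ k, n < k → k ∈ TC.sem M C}
  | .untl C D => {n | ∃ k, n < k ∧ k ∈ TC.sem M D ∧ ∀ m, n < m → m < k → m ∈ TC.sem M C}
  | .nextP C => {n | n - 1 ∈ TC.sem M C}
  | .diamP C => {n | ∃ k, k < n ∧ k ∈ TC.sem M C}
  | .boxP C => {n | ∀ k, k < n → k ∈ TC.sem M C}
  | .since C D => {n | ∃ k, k < n ∧ k ∈ TC.sem M D ∧ ∀ m, k < m → m < n → m ∈ TC.sem M C}

/-- Basic temporal concepts: built from atomic concepts using ○F, ○P, □F, □P. -/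
inductive TC.IsBasic : TC → Prop
  | atom (a : ℕ) : TC.IsBasic (.atom a)
  | nextF {C : TC} : TC.IsBasic C → TC.IsBasic (.nextF C)
  | nextP {C : TC} : TC.IsBasic C → TC.IsBasic (.nextP C)
  | boxF {C : TC} : TC.IsBasic C → TC.IsBasic (.boxF C)
  | boxP {C : TC} : TC.IsBasic C → TC.IsBasic (.boxP C)

/-- Basic temporal concepts using □F and □P only. -/
inductive TC.IsBasicBox : TC → Prop
  | atom (a : ℕ) : TC.IsBasicBox (.atom a)
  | boxF {C : TC} : TC.IsBasicBox C → TC.IsBasicBox (.boxF C)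
  | boxP {C : TC} : TC.IsBasicBox C → TC.IsBasicBox (.boxP C)

/-- Basic temporal concepts using ○F and ○P only. -/
inductive TC.IsBasicNext : TC → Prop
  | atom (a : ℕ) : TC.IsBasicNext (.atom a)
  | nextF {C : TC} : TC.IsBasicNext C → TC.IsBasicNext (.nextF C)
  | nextP {C : TC} : TC.IsBasicNext C → TC.IsBasicNext (.nextP C)

/-- Positive temporal concepts: no occurrences of ¬. -/
inductive TC.IsPositive : TC → Prop
  | top : TC.IsPositive .top
  | atom (a : ℕ) : TC.IsPositive (.atom a)
  | and {C D : TC} : TC.IsPositive C → TC.IsPositive D → TC.IsPositive (.and C D)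
  | or {C D : TC} : TC.IsPositive C → TC.IsPositive D → TC.IsPositive (.or C D)
  | nextF {C : TC} : TC.IsPositive C → TC.IsPositive (.nextF C)
  | diamF {C : TC} : TC.IsPositive C → TC.IsPositive (.diamF C)
  | boxF {C : TC} : TC.IsPositive C → TC.IsPositive (.boxF C)
  | untl {C D : TC} : TC.IsPositive C → TC.IsPositive D → TC.IsPositive (.untl C D)
  | nextP {C : TC} : TC.IsPositive C → TC.IsPositive (.nextP C)
  | diamP {C : TC} : TC.IsPositive C → TC.IsPositive (.diamP C)
  | boxP {C : TC} : TC.IsPositive C → TC.IsPositive (.boxP C)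
  | since {C D : TC} : TC.IsPositive C → TC.IsPositive D → TC.IsPositive (.since C D)

/-- Prior-LTL formulas: Boolean connectives and □P, ◇P, □F, ◇F only. -/
inductive TC.IsPrior : TC → Prop
  | atom (a : ℕ) : TC.IsPrior (.atom a)
  | neg {C : TC} : TC.IsPrior C → TC.IsPrior (.neg C)
  | and {C D : TC} : TC.IsPrior C → TC.IsPrior D → TC.IsPrior (.and C D)
  | or {C D : TC} : TC.IsPrior C → TC.IsPrior D → TC.IsPrior (.or C D)
  | boxF {C : TC} : TC.IsPrior C → TC.IsPrior (.boxF C)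
  | boxP {C : TC} : TC.IsPrior C → TC.IsPrior (.boxP C)
  | diamF {C : TC} : TC.IsPrior C → TC.IsPrior (.diamF C)
  | diamP {C : TC} : TC.IsPrior C → TC.IsPrior (.diamP C)

/-- Number of occurrences of temporal operators in a temporal concept. -/
def TC.tempOps : TC → ℕ
  | .top => 0
  | .atom _ => 0
  | .neg C => TC.tempOps C
  | .and C D => TC.tempOps C + TC.tempOps D
  | .or C D => TC.tempOps C + TC.tempOps D
  | .nextF C => TC.tempOps C + 1
  | .diamF C => TC.tempOps C + 1
  | .boxF C => TC.tempOps C + 1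
  | .untl C D => TC.tempOps C + TC.tempOps D + 1
  | .nextP C => TC.tempOps C + 1
  | .diamP C => TC.tempOps C + 1
  | .boxP C => TC.tempOps C + 1
  | .since C D => TC.tempOps C + TC.tempOps D + 1

/-- Number of occurrences of symbols in a temporal concept. -/
def TC.size : TC → ℕ
  | .top => 1
  | .atom _ => 1
  | .neg C => TC.size C + 1
  | .and C D => TC.size C + TC.size D + 1
  | .or C D => TC.size C + TC.size D + 1
  | .nextF C => TC.size C + 1
  | .diamF C => TC.size C + 1
  | .boxF C => TC.size C + 1
  | .untl C D => TC.size C + TC.size D + 1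
  | .nextP C => TC.size C + 1
  | .diamP C => TC.size C + 1
  | .boxP C => TC.size C + 1
  | .since C D => TC.size C + TC.size D + 1

/-- The set of subconcepts of a temporal concept. -/
def TC.subs : TC → Set TC
  | .top => {.top}
  | .atom a => {.atom a}
  | .neg C => insert (.neg C) (TC.subs C)
  | .and C D => insert (.and C D) (TC.subs C ∪ TC.subs D)
  | .or C D => insert (.or C D) (TC.subs C ∪ TC.subs D)
  | .nextF C => insert (.nextF C) (TC.subs C)
  | .diamF C => insert (.diamF C) (TC.subs C)
  | .boxF C => insert (.boxF C) (TC.subs C)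
  | .untl C D => insert (.untl C D) (TC.subs C ∪ TC.subs D)
  | .nextP C => insert (.nextP C) (TC.subs C)
  | .diamP C => insert (.diamP C) (TC.subs C)
  | .boxP C => insert (.boxP C) (TC.subs C)
  | .since C D => insert (.since C D) (TC.subs C ∪ TC.subs D)

/-- The set of atomic concepts occurring in a temporal concept. -/
def TC.atoms : TC → Set ℕ
  | .top => ∅
  | .atom a => {a}
  | .neg C => TC.atoms C
  | .and C D => TC.atoms C ∪ TC.atoms D
  | .or C D => TC.atoms C ∪ TC.atoms D
  | .nextF C => TC.atoms C
  | .diamF C => TC.atoms C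
  | .boxF C => TC.atoms C
  | .untl C D => TC.atoms C ∪ TC.atoms D
  | .nextP C => TC.atoms C
  | .diamP C => TC.atoms C
  | .boxP C => TC.atoms C
  | .since C D => TC.atoms C ∪ TC.atoms D

/-! ## Clauses, ontologies, data instances -/

/-- A clause `C₁ ∧ … ∧ C_k → C_{k+1} ∨ … ∨ C_{k+m}`. -/
structure Clause : Type where
  prem : List TC
  concl : List TC

/-- A clause is true in `M` if the intersection of the extensions of the premises
is contained in the union of the extensions of the conclusions. -/
def Clause.holds (M : Itp) (cl : Clause) : Prop :=
  ∀ n : ℤ, (∀ C ∈ cl.prem, n ∈ TC.sem M C) → ∃ C ∈ cl.concl, n ∈ TC.sem M C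

/-- An ontology is a finite set (list) of clauses. -/
abbrev Ontology : Type := List Clause

def Clause.AllBasic (cl : Clause) : Prop :=
  (∀ C ∈ cl.prem, C.IsBasic) ∧ (∀ C ∈ cl.concl, C.IsBasic)

def Clause.AllBasicBox (cl : Clause) : Prop :=
  (∀ C ∈ cl.prem, C.IsBasicBox) ∧ (∀ C ∈ cl.concl, C.IsBasicBox)

def Clause.AllBasicNext (cl : Clause) : Prop :=
  (∀ C ∈ cl.prem, C.IsBasicNext) ∧ (∀ C ∈ cl.concl, C.IsBasicNext)

/-- Horn: at most one disjunct in the conclusion. -/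
def Clause.Horn (cl : Clause) : Prop := cl.concl.length ≤ 1

/-- Krom (binary): at most two concepts altogether. -/
def Clause.Krom (cl : Clause) : Prop := cl.prem.length + cl.concl.length ≤ 2

/-- LTL_bool^□○ ontologies. -/
def Ontology.BoolBoxNext (O : Ontology) : Prop := ∀ cl ∈ O, cl.AllBasic
/-- LTL_bool^□ ontologies. -/
def Ontology.BoolBox (O : Ontology) : Prop := ∀ cl ∈ O, cl.AllBasicBox
/-- LTL_krom^○ ontologies. -/
def Ontology.KromNext (O : Ontology) : Prop := ∀ cl ∈ O, cl.AllBasicNext ∧ cl.Krom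
/-- LTL_krom^□○ ontologies. -/
def Ontology.KromBoxNext (O : Ontology) : Prop := ∀ cl ∈ O, cl.AllBasic ∧ cl.Krom
/-- LTL_horn^□○ ontologies. -/
def Ontology.HornBoxNext (O : Ontology) : Prop := ∀ cl ∈ O, cl.AllBasic ∧ cl.Horn
/-- LTL_horn^□ ontologies. -/
def Ontology.HornBox (O : Ontology) : Prop := ∀ cl ∈ O, cl.AllBasicBox ∧ cl.Horn
/-- LTL_core^□○ ontologies. -/
def Ontology.CoreBoxNext (O : Ontology) : Prop := ∀ cl ∈ O, cl.AllBasic ∧ cl.Horn ∧ cl.Krom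

/-- Number of occurrences of symbols in a clause. -/
def Clause.size (cl : Clause) : ℕ :=
  (cl.prem.map TC.size).sum + (cl.concl.map TC.size).sum + 1

/-- Number of occurrences of symbols in an ontology. -/
def Ontology.size (O : Ontology) : ℕ := (O.map Clause.size).sum

/-- The atomic concept `a` occurs in the ontology `O`. -/
def Ontology.occurs (O : Ontology) (a : ℕ) : Prop :=
  ∃ cl ∈ O, (∃ C ∈ cl.prem, a ∈ C.atoms) ∨ (∃ C ∈ cl.concl, a ∈ C.atoms)

/-- The set of subconcepts of (concepts occurring in) an ontology. -/
def Ontology.subs (O : Ontology) : Set TC :=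
  {C | ∃ cl ∈ O, ∃ D : TC, (D ∈ cl.prem ∨ D ∈ cl.concl) ∧ C ∈ D.subs}

/-- A flat concept: an atomic concept, or a single ○F or ○P applied to an atomic concept. -/
def TC.IsFlat : TC → Prop
  | .atom _ => True
  | .nextF (.atom _) => True
  | .nextP (.atom _) => True
  | _ => False

/-- An ontology without nested temporal operators. -/
def Ontology.Flat (O : Ontology) : Prop :=
  ∀ cl ∈ O, (∀ C ∈ cl.prem, C.IsFlat) ∧ (∀ C ∈ cl.concl, C.IsFlat)

/-- A data instance: a finite nonempty set of timestamped atoms, normalized so that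
the minimal timestamp is 0 and the maximal one is ≥ 1. -/
structure DataInstance : Type where
  atoms : Finset (ℕ × ℤ)
  nonneg : ∀ p ∈ atoms, 0 ≤ p.2
  has_zero : ∃ p ∈ atoms, p.2 = 0
  has_one : ∃ p ∈ atoms, 1 ≤ p.2

theorem DataInstance.ts_nonempty (A : DataInstance) :
    (A.atoms.image Prod.snd).Nonempty := by
  obtain ⟨p, hp, -⟩ := A.has_zero
  exact ⟨p.2, Finset.mem_image_of_mem _ hp⟩

/-- min A: the minimal timestamp occurring in the data instance (equal to 0). -/
def DataInstance.minT (A : DataInstance) : ℤ :=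
  (A.atoms.image Prod.snd).min' A.ts_nonempty

/-- max A: the maximal timestamp occurring in the data instance. -/
def DataInstance.maxT (A : DataInstance) : ℤ :=
  (A.atoms.image Prod.snd).max' A.ts_nonempty

/-- The active temporal domain tem(A). -/
def DataInstance.tem (A : DataInstance) : Set ℤ := Set.Icc A.minT A.maxT

/-- The interpretation of atomic concepts in the first-order structure S_A. -/
def DataInstance.itp (A : DataInstance) : Itp := fun a => {n | (a, n) ∈ A.atoms}

/-- `M` is a model of the knowledge base `(O, A)`. -/
def IsModel (M : Itp) (O : Ontology) (A : DataInstance) : Prop :=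
  (∀ cl ∈ O, cl.holds M) ∧ ∀ p ∈ A.atoms, p.2 ∈ M p.1

/-- The ontology `O` is consistent. -/
def Ontology.Consistent (O : Ontology) : Prop := ∃ M : Itp, ∀ cl ∈ O, cl.holds M

/-- The data instance `A` is consistent with `O`. -/
def ConsistentWith (O : Ontology) (A : DataInstance) : Prop := ∃ M : Itp, IsModel M O A

/-- Certain answers to the OMIQ `(O, κ)` over `A` (within the active domain). -/
def certAns (O : Ontology) (κ : TC) (A : DataInstance) : Set ℤ :=
  {ℓ | ℓ ∈ A.tem ∧ ∀ M : Itp, IsModel M O A → ℓ ∈ TC.sem M κ}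

/-- Certain answers to the OMIQ `(O, κ)` over `A` and ℤ. -/
def certAnsZ (O : Ontology) (κ : TC) (A : DataInstance) : Set ℤ :=
  {ℓ | ∀ M : Itp, IsModel M O A → ℓ ∈ TC.sem M κ}

/-! ## First-order, MSO and FO(RPR) formulas over the temporal structures -/

/-- Formulas of the target languages: first-order variables are indexed by `ℕ`,
as are second-order (set) variables and the recursively defined relation variables
of FO(RPR).  The constructors `qprev j` and `qapp j x` stand for `Q_j(t-1)` (inside
a recursive definition block) and `Q_j(x)`, respectively; `rpr n Θ tv ψ` is the
relational-primitive-recursion construct `[Q₁(t) ≡ Θ₁; …; Q_n(t) ≡ Θ_n] ψ`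
with recursion variable `tv`. -/
inductive Fml : Type where
  | falsum : Fml
  | atom : ℕ → ℕ → Fml        -- A(x)
  | lt : ℕ → ℕ → Fml          -- x < y
  | eq : ℕ → ℕ → Fml          -- x = y
  | succ : ℕ → ℕ → Fml        -- x = y + 1
  | mod : ℕ → ℕ → Fml         -- x ≡ 0 (mod n)
  | svar : ℕ → ℕ → Fml        -- X(x), X a set variable
  | qprev : ℕ → Fml           -- Q_j(t−1)
  | qapp : ℕ → ℕ → Fml        -- Q_j(x)
  | neg : Fml → Fml
  | and : Fml → Fml → Fml
  | or : Fml → Fml → Fml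
  | ex : ℕ → Fml → Fml
  | all : ℕ → Fml → Fml
  | exS : ℕ → Fml → Fml       -- second-order ∃
  | allS : ℕ → Fml → Fml      -- second-order ∀
  | rpr : (n : ℕ) → (Fin n → Fml) → ℕ → Fml → Fml

/-- Evaluation of a formula over the structure with (active) domain `D ⊆ ℤ`
and interpretation `I` of the unary predicates; `env` assigns first-order
variables, `senv` set variables, `prev` the placeholders `Q_j(t-1)` and
`Q` the defined relation variables. First-order quantifiers range over `D`,
second-order quantifiers over subsets of `D`. -/
def Fml.eval (D : Set ℤ) (I : ℕ → Set ℤ) :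
    Fml → (ℕ → ℤ) → (ℕ → Set ℤ) → (ℕ → Prop) → (ℕ → ℤ → Prop) → Prop
  | .falsum, _, _, _, _ => False
  | .atom a x, env, _, _, _ => env x ∈ I a
  | .lt x y, env, _, _, _ => env x < env y
  | .eq x y, env, _, _, _ => env x = env y
  | .succ x y, env, _, _, _ => env x = env y + 1
  | .mod n x, env, _, _, _ => (n : ℤ) ∣ env x
  | .svar X x, env, senv, _, _ => env x ∈ senv X
  | .qprev j, _, _, prev, _ => prev j
  | .qapp j x, env, _, _, Q => Q j (env x)
  | .neg φ, env, senv, prev, Q => ¬ Fml.eval D I φ env senv prev Q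
  | .and φ ψ, env, senv, prev, Q =>
      Fml.eval D I φ env senv prev Q ∧ Fml.eval D I ψ env senv prev Q
  | .or φ ψ, env, senv, prev, Q =>
      Fml.eval D I φ env senv prev Q ∨ Fml.eval D I ψ env senv prev Q
  | .ex x φ, env, senv, prev, Q =>
      ∃ d ∈ D, Fml.eval D I φ (Function.update env x d) senv prev Q
  | .all x φ, env, senv, prev, Q =>
      ∀ d ∈ D, Fml.eval D I φ (Function.update env x d) senv prev Q
  | .exS X φ, env, senv, prev, Q =>
      ∃ S : Set ℤ, S ⊆ D ∧ Fml.eval D I φ env (Function.update senv X S) prev Q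
  | .allS X φ, env, senv, prev, Q =>
      ∀ S : Set ℤ, S ⊆ D → Fml.eval D I φ env (Function.update senv X S) prev Q
  | .rpr n Θ tv ψ, env, senv, prev, Q =>
      -- the semantics of each Θ_j, as a function of the first-order environment
      -- and of the truth values of the `Q_j(t−1)` placeholders
      let f : Fin n → (ℕ → ℤ) → (ℕ → Prop) → Prop :=
        fun j env' prev' => Fml.eval D I (Θ j) env' senv prev' Q
      -- the recursively computed truth values of `Q_j` at time `k` (recursion on k from 0)
      let recQ : ℕ → Fin n → Prop := fun k =>
        Nat.rec (fun j => f j (Function.update env tv 0) (fun _ => False))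
          (fun m ih j => f j (Function.update env tv ((m : ℤ) + 1))
            (fun i => ∃ h : i < n, ih ⟨i, h⟩)) k
      Fml.eval D I ψ env senv prev
        (fun j z => ∃ h : j < n, 0 ≤ z ∧ recQ z.toNat ⟨j, h⟩)

/-- Free first-order variables of a formula. -/
def Fml.fvars : Fml → Set ℕ
  | .falsum => ∅
  | .atom _ x => {x}
  | .lt x y => {x, y}
  | .eq x y => {x, y}
  | .succ x y => {x, y}
  | .mod _ x => {x}
  | .svar _ x => {x}
  | .qprev _ => ∅
  | .qapp _ x => {x}
  | .neg φ => Fml.fvars φ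
  | .and φ ψ => Fml.fvars φ ∪ Fml.fvars ψ
  | .or φ ψ => Fml.fvars φ ∪ Fml.fvars ψ
  | .ex x φ => Fml.fvars φ \ {x}
  | .all x φ => Fml.fvars φ \ {x}
  | .exS _ φ => Fml.fvars φ
  | .allS _ φ => Fml.fvars φ
  | .rpr n Θ tv ψ => (⋃ j : Fin n, Fml.fvars (Θ j) \ {tv}) ∪ Fml.fvars ψ

/-- FO(<)-formulas: first-order logic with the built-in linear order
(and the definable equality predicate); no constants, no arithmetic. -/
def Fml.IsFOlt : Fml → Prop
  | .falsum => True
  | .atom _ _ => True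
  | .lt _ _ => True
  | .eq _ _ => True
  | .neg φ => Fml.IsFOlt φ
  | .and φ ψ => Fml.IsFOlt φ ∧ Fml.IsFOlt ψ
  | .or φ ψ => Fml.IsFOlt φ ∧ Fml.IsFOlt ψ
  | .ex _ φ => Fml.IsFOlt φ
  | .all _ φ => Fml.IsFOlt φ
  | _ => False

/-- FO(<,≡)-formulas: FO(<) extended with the predicates `t ≡ 0 (mod n)`, `n > 1`. -/
def Fml.IsFOltMod : Fml → Prop
  | .falsum => True
  | .atom _ _ => True
  | .lt _ _ => True
  | .eq _ _ => True
  | .mod n _ => 2 ≤ n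
  | .neg φ => Fml.IsFOltMod φ
  | .and φ ψ => Fml.IsFOltMod φ ∧ Fml.IsFOltMod ψ
  | .or φ ψ => Fml.IsFOltMod φ ∧ Fml.IsFOltMod ψ
  | .ex _ φ => Fml.IsFOltMod φ
  | .all _ φ => Fml.IsFOltMod φ
  | _ => False

/-- MSO(<)-formulas: FO(<) extended with set variables and second-order quantifiers. -/
def Fml.IsMSO : Fml → Prop
  | .falsum => True
  | .atom _ _ => True
  | .lt _ _ => True
  | .eq _ _ => True
  | .svar _ _ => True
  | .neg φ => Fml.IsMSO φ
  | .and φ ψ => Fml.IsMSO φ ∧ Fml.IsMSO ψ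
  | .or φ ψ => Fml.IsMSO φ ∧ Fml.IsMSO ψ
  | .ex _ φ => Fml.IsMSO φ
  | .all _ φ => Fml.IsMSO φ
  | .exS _ φ => Fml.IsMSO φ
  | .allS _ φ => Fml.IsMSO φ
  | _ => False

/-- FO(RPR)-formulas: FO(<) extended with successor and relational primitive recursion. -/
def Fml.IsRPR : Fml → Prop
  | .falsum => True
  | .atom _ _ => True
  | .lt _ _ => True
  | .eq _ _ => True
  | .succ _ _ => True
  | .qprev _ => True
  | .qapp _ _ => True
  | .neg φ => Fml.IsRPR φ
  | .and φ ψ => Fml.IsRPR φ ∧ Fml.IsRPR ψ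
  | .or φ ψ => Fml.IsRPR φ ∧ Fml.IsRPR ψ
  | .ex _ φ => Fml.IsRPR φ
  | .all _ φ => Fml.IsRPR φ
  | .rpr n Θ _ ψ => (∀ j : Fin n, Fml.IsRPR (Θ j)) ∧ Fml.IsRPR ψ
  | _ => False

/-- MFO(<)-formulas: monadic first-order formulas built from atoms `A(t)`,
`t < t'`, `t = t'` and `t = t' + 1`. -/
def Fml.IsMFO : Fml → Prop
  | .falsum => True
  | .atom _ _ => True
  | .lt _ _ => True
  | .eq _ _ => True
  | .succ _ _ => True
  | .neg φ => Fml.IsMFO φ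
  | .and φ ψ => Fml.IsMFO φ ∧ Fml.IsMFO ψ
  | .or φ ψ => Fml.IsMFO φ ∧ Fml.IsMFO ψ
  | .ex _ φ => Fml.IsMFO φ
  | .all _ φ => Fml.IsMFO φ
  | _ => False

/-- Quasi-positive MFO(<)-formulas: built from atoms `A(t)`, `t < t'`, `t = t'`,
`t = t' + 1` (and ⊥) using ∧, ∨, ∃, ∀ as well as guarded universal quantification
`∀y (x < y < z → φ)`, `∀y (x < y → φ)`, `∀y (y < z → φ)`
(the guarded implications are encoded via `¬guard ∨ φ`). -/
inductive Fml.IsQP : Fml → Prop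
  | falsum : Fml.IsQP .falsum
  | atom (a x : ℕ) : Fml.IsQP (.atom a x)
  | lt (x y : ℕ) : Fml.IsQP (.lt x y)
  | eq (x y : ℕ) : Fml.IsQP (.eq x y)
  | succ (x y : ℕ) : Fml.IsQP (.succ x y)
  | and {φ ψ : Fml} : Fml.IsQP φ → Fml.IsQP ψ → Fml.IsQP (.and φ ψ)
  | or {φ ψ : Fml} : Fml.IsQP φ → Fml.IsQP ψ → Fml.IsQP (.or φ ψ)
  | ex (x : ℕ) {φ : Fml} : Fml.IsQP φ → Fml.IsQP (.ex x φ)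
  | all (x : ℕ) {φ : Fml} : Fml.IsQP φ → Fml.IsQP (.all x φ)
  | allBtw (y x z : ℕ) {φ : Fml} : Fml.IsQP φ →
      Fml.IsQP (.all y (.or (.neg (.and (.lt x y) (.lt y z))) φ))
  | allGt (y x : ℕ) {φ : Fml} : Fml.IsQP φ →
      Fml.IsQP (.all y (.or (.neg (.lt x y)) φ))
  | allLt (y z : ℕ) {φ : Fml} : Fml.IsQP φ →
      Fml.IsQP (.all y (.or (.neg (.lt y z)) φ))

/-- Evaluation in a structure with domain `D` and unary predicates `I`
(no set variables, placeholders or relation variables supplied). -/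
def Fml.evalIn (D : Set ℤ) (I : Itp) (φ : Fml) (env : ℕ → ℤ) : Prop :=
  Fml.eval D I φ env (fun _ => ∅) (fun _ => False) (fun _ _ => False)

/-- An MFO(<)-formula is monotone if it is preserved under adding time points
to the extensions of the atomic concepts. -/
def MonotoneFml (ψ : Fml) : Prop :=
  ∀ M₁ M₂ : Itp, (∀ a : ℕ, M₁ a ⊆ M₂ a) → ∀ env : ℕ → ℤ,
    Fml.evalIn Set.univ M₁ ψ env → Fml.evalIn Set.univ M₂ ψ env

/-! ## The canonical model of a Horn ontology and a data instance -/

/-- Atoms of the closure: ⊥ or `C(n)` for a (basic) temporal concept `C` and `n ∈ ℤ`. -/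
inductive EAtom : Type where
  | bot : EAtom
  | conc : TC → ℤ → EAtom

/-- One (non-recursive) application of the closure rules of the canonical model. -/
def clStep (O : Ontology) (Λ : Set EAtom) : Set EAtom :=
  Λ ∪
  {e | ∃ cl ∈ O, ∃ n : ℤ, (∀ C ∈ cl.prem, EAtom.conc C n ∈ Λ) ∧
        ((∃ C : TC, cl.concl = [C] ∧ e = EAtom.conc C n) ∨
          (cl.concl = [] ∧ e = EAtom.bot))} ∪
  {e | ∃ C : TC, ∃ n k : ℤ, n < k ∧ EAtom.conc (.boxF C) n ∈ Λ ∧ e = EAtom.conc C k} ∪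
  {e | ∃ C : TC, ∃ n : ℤ, (∀ k : ℤ, n < k → EAtom.conc C k ∈ Λ) ∧
        e = EAtom.conc (.boxF C) n} ∪
  {e | ∃ C : TC, ∃ n : ℤ, EAtom.conc (.nextF C) n ∈ Λ ∧ e = EAtom.conc C (n + 1)} ∪
  {e | ∃ C : TC, ∃ n : ℤ, EAtom.conc C (n + 1) ∈ Λ ∧ e = EAtom.conc (.nextF C) n} ∪
  {e | ∃ C : TC, ∃ n k : ℤ, k < n ∧ EAtom.conc (.boxP C) n ∈ Λ ∧ e = EAtom.conc C k} ∪
  {e | ∃ C : TC, ∃ n : ℤ, (∀ k : ℤ, k < n → EAtom.conc C k ∈ Λ) ∧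
        e = EAtom.conc (.boxP C) n} ∪
  {e | ∃ C : TC, ∃ n : ℤ, EAtom.conc (.nextP C) n ∈ Λ ∧ e = EAtom.conc C (n - 1)} ∪
  {e | ∃ C : TC, ∃ n : ℤ, EAtom.conc C (n - 1) ∈ Λ ∧ e = EAtom.conc (.nextP C) n}

/-- Transfinite iteration of the closure rules. -/
noncomputable def clIter (O : Ontology) (Λ : Set EAtom) (o : Ordinal.{0}) : Set EAtom :=
  Ordinal.limitRecOn o Λ (fun _ ih => clStep O ih)
    (fun o _ ih => ⋃ (o' : Ordinal.{0}), ⋃ (h : o' < o), ih o' h)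

/-- The atoms of a data instance, as a set of closure atoms. -/
def dataAtoms (A : DataInstance) : Set EAtom :=
  {e | ∃ p ∈ A.atoms, e = EAtom.conc (.atom p.1) p.2}

open Ordinal in
/-- The canonical model `C_{O,A}`: the closure of `A` under the rules,
iterated up to the first uncountable ordinal ω₁. -/
noncomputable def canon (O : Ontology) (A : DataInstance) : Set EAtom :=
  clIter O (dataAtoms A) (Ordinal.omega 1)

/-- The canonical model regarded as a temporal interpretation. -/
noncomputable def canonItp (O : Ontology) (A : DataInstance) : Itp :=
  fun a => {n | EAtom.conc (.atom a) n ∈ canon O A}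

/-- The type `τ_{O,A}(n)`: the set of subconcepts of `O` that hold at `n`
in the canonical model. -/
noncomputable def tau (O : Ontology) (A : DataInstance) (n : ℤ) : Set TC :=
  {C ∈ O.subs | n ∈ TC.sem (canonItp O A) C}

/-! ## Literals and the reachability relation ⇝ for Krom ontologies -/

/-- A simple literal: an atomic concept with a polarity. -/
abbrev Lit : Type := ℕ × Bool

/-- The temporal concept corresponding to a literal. -/
def Lit.toTC (L : Lit) : TC := if L.2 then .atom L.1 else .neg (.atom L.1)

def TC.iterF : ℕ → TC → TC
  | 0, C => C
  | k + 1, C => .nextF (TC.iterF k C)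

def TC.iterP : ℕ → TC → TC
  | 0, C => C
  | k + 1, C => .nextP (TC.iterP k C)

/-- `○^k C`: `k` occurrences of ○F if `k > 0`, of ○P if `k < 0`. -/
def TC.shift (k : ℤ) (C : TC) : TC :=
  if 0 ≤ k then TC.iterF k.toNat C else TC.iterP (-k).toNat C

/-- `(L₁,n₁) ⇝ (L₂,n₂)`: in every model of `O`,
`(○^{n₁} L₁)^M ⊆ (○^{n₂} L₂)^M`. -/
def leadsTo (O : Ontology) (L₁ : Lit) (n₁ : ℤ) (L₂ : Lit) (n₂ : ℤ) : Prop :=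
  ∀ M : Itp, (∀ cl ∈ O, cl.holds M) →
    TC.sem M (TC.shift n₁ L₁.toTC) ⊆ TC.sem M (TC.shift n₂ L₂.toTC)


/-- The pointwise majority of three interpretations. -/
def Itp.majority (M₁ M₂ M₃ : Itp) : Itp :=
  fun a => M₁ a ∩ M₂ a ∪ M₁ a ∩ M₃ a ∪ M₂ a ∩ M₃ a

/-- The translation of an interpretation by `d` time points. -/
def Itp.translate (M : Itp) (d : ℤ) : Itp := fun a => {n | n + d ∈ M a}

theorem TC.IsBasicNext.mem_sem_majority {C : TC} (hC : C.IsBasicNext) (M₁ M₂ M₃ : Itp) (n : ℤ) :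
    n ∈ C.sem (Itp.majority M₁ M₂ M₃) ↔
      (n ∈ C.sem M₁ ∧ n ∈ C.sem M₂) ∨ (n ∈ C.sem M₁ ∧ n ∈ C.sem M₃) ∨
        (n ∈ C.sem M₂ ∧ n ∈ C.sem M₃) := by
  induction hC generalizing n with
  | atom a => simp [TC.sem, Itp.majority, or_assoc]
  | nextF _ ih => exact ih (n + 1)
  | nextP _ ih => exact ih (n - 1)

theorem TC.IsBasicNext.mem_sem_translate {C : TC} (hC : C.IsBasicNext) (M : Itp) (d n : ℤ) :
    n ∈ C.sem (M.translate d) ↔ n + d ∈ C.sem M := by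
  induction hC generalizing n with
  | atom a => rfl
  | nextF _ ih =>
    refine (ih (n + 1)).trans ?_
    rw [add_right_comm]
    rfl
  | nextP _ ih =>
    refine (ih (n - 1)).trans ?_
    rw [sub_add_eq_add_sub]
    rfl

/-- Truth of a binary clause is preserved under pointwise majority. -/
theorem Clause.Krom.holds_majority {cl : Clause} (hk : cl.Krom) (hb : cl.AllBasicNext)
    {M₁ M₂ M₃ : Itp} (h₁ : cl.holds M₁) (h₂ : cl.holds M₂) (h₃ : cl.holds M₃) :
    cl.holds (Itp.majority M₁ M₂ M₃) := by
  intro n hprem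
  have h₁ := h₁ n
  have h₂ := h₂ n
  have h₃ := h₃ n
  by_contra! hconcl
  replace hprem := fun C hC => ((hb.1 C hC).mem_sem_majority M₁ M₂ M₃ n).1 (hprem C hC)
  replace hconcl := fun C hC =>
    mt ((hb.2 C hC).mem_sem_majority M₁ M₂ M₃ n).2 (hconcl C hC)
  clear hb
  obtain ⟨ps, cs⟩ := cl
  simp only [Clause.Krom] at hk
  rcases ps with _ | ⟨p, _ | ⟨p', _ | ⟨p'', ps⟩⟩⟩ <;>
  rcases cs with _ | ⟨c, _ | ⟨c', _ | ⟨c'', cs⟩⟩⟩ <;>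
  simp only [List.length_cons, List.length_nil] at hk <;>
  first
  | omega
  | (simp only [List.mem_cons, List.not_mem_nil, or_false, forall_eq_or_imp, forall_eq,
      exists_eq_or_imp, exists_eq_left, false_and, exists_false, false_imp_iff, implies_true,
      true_imp_iff] at h₁ h₂ h₃ hprem hconcl <;>
      tauto)

theorem Clause.AllBasicNext.holds_translate {cl : Clause} (hb : cl.AllBasicNext) {M : Itp}
    (h : cl.holds M) (d : ℤ) : cl.holds (M.translate d) := by
  intro n hprem
  obtain ⟨C, hC, hn⟩ := h (n + d) fun C hC =>
    ((hb.1 C hC).mem_sem_translate M d n).1 (hprem C hC)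
  exact ⟨C, hC, ((hb.2 C hC).mem_sem_translate M d n).2 hn⟩

/-- Helly property of Krom ontologies: ground atoms that are pairwise satisfiable together with
the ontology are jointly satisfiable with it. -/
theorem Ontology.KromNext.exists_model_of_pairwise {O : Ontology} (hO : O.KromNext)
    {S : Finset (ℕ × ℤ)}
    (hpair : ∀ p ∈ S, ∀ q ∈ S,
      ∃ M : Itp, (∀ cl ∈ O, cl.holds M) ∧ p.2 ∈ M p.1 ∧ q.2 ∈ M q.1)
    (T : Finset (ℕ × ℤ)) (hT : T ⊆ S) {p q : ℕ × ℤ} (hp : p ∈ S) (hq : q ∈ S) :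
    ∃ M : Itp, (∀ cl ∈ O, cl.holds M) ∧ (∀ r ∈ T, r.2 ∈ M r.1) ∧ p.2 ∈ M p.1 ∧ q.2 ∈ M q.1 := by
  induction T using Finset.induction_on generalizing p q with
  | empty =>
    obtain ⟨M, hM, h⟩ := hpair p hp q hq
    exact ⟨M, hM, by simp, h⟩
  | insert c T _ ih =>
    obtain ⟨hc, hT⟩ := Finset.insert_subset_iff.1 hT
    obtain ⟨M₁, hM₁, hT₁, hp₁, hq₁⟩ := ih hT hp hq
    obtain ⟨M₂, hM₂, hT₂, hp₂, hc₂⟩ := ih hT hp hc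
    obtain ⟨M₃, hM₃, hT₃, hq₃, hc₃⟩ := ih hT hq hc
    refine ⟨Itp.majority M₁ M₂ M₃,
      fun cl hcl => (hO cl hcl).2.holds_majority (hO cl hcl).1 (hM₁ cl hcl) (hM₂ cl hcl)
        (hM₃ cl hcl), ?_, Or.inl (Or.inl ⟨hp₁, hp₂⟩), Or.inl (Or.inr ⟨hq₁, hq₃⟩)⟩
    intro r hr
    rcases Finset.mem_insert.1 hr with rfl | hr
    · exact Or.inr ⟨hc₂, hc₃⟩
    · exact Or.inl (Or.inl ⟨hT₁ r hr, hT₂ r hr⟩)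

theorem TC.mem_sem_iterF (M : Itp) (C : TC) (k : ℕ) (n : ℤ) :
    n ∈ (TC.iterF k C).sem M ↔ n + k ∈ C.sem M := by
  induction k generalizing n with
  | zero => simp [TC.iterF]
  | succ k ih =>
    refine (ih (n + 1)).trans ?_
    rw [Nat.cast_succ, add_assoc, add_comm (1 : ℤ)]

theorem TC.mem_sem_iterP (M : Itp) (C : TC) (k : ℕ) (n : ℤ) :
    n ∈ (TC.iterP k C).sem M ↔ n - k ∈ C.sem M := by
  induction k generalizing n with
  | zero => simp [TC.iterP]
  | succ k ih =>
    refine (ih (n - 1)).trans ?_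
    rw [Nat.cast_succ, sub_sub, add_comm (1 : ℤ)]

theorem TC.mem_sem_shift (M : Itp) (C : TC) (k n : ℤ) :
    n ∈ (TC.shift k C).sem M ↔ n + k ∈ C.sem M := by
  unfold TC.shift
  split_ifs with h
  · rw [TC.mem_sem_iterF, Int.toNat_of_nonneg h]
  · rw [TC.mem_sem_iterP, Int.toNat_of_nonneg (by omega), sub_neg_eq_add]

theorem leadsTo_true_false_iff {O : Ontology} {a b : ℕ} {k l : ℤ} :
    leadsTo O (a, true) k (b, false) l ↔
      ∀ M : Itp, (∀ cl ∈ O, cl.holds M) → ∀ n : ℤ, n + k ∈ M a → n + l ∉ M b := by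
  simp only [leadsTo, Set.subset_def, TC.mem_sem_shift]
  rfl

/-- inconsistency of a data instance with an LTL_krom^○
ontology via the reachability relation ⇝. -/
theorem kromNext_inconsistent_iff_leadsTo (O : Ontology) (hO : O.KromNext)
    (hflat : O.Flat) (hcons : O.Consistent) (A : DataInstance) :
    ¬ ConsistentWith O A ↔
      ∃ p ∈ A.atoms, ∃ q ∈ A.atoms, leadsTo O (p.1, true) p.2 (q.1, false) q.2 := by
  refine ⟨fun hincons => ?_, ?_⟩
  · by_contra! hnot
    have hpair : ∀ p ∈ A.atoms, ∀ q ∈ A.atoms,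
        ∃ M : Itp, (∀ cl ∈ O, cl.holds M) ∧ p.2 ∈ M p.1 ∧ q.2 ∈ M q.1 := by
      intro p hp q hq
      have h := hnot p hp q hq
      rw [leadsTo_true_false_iff] at h
      push Not at h
      obtain ⟨M, hM, n, hpn, hqn⟩ := h
      refine ⟨M.translate n, fun cl hcl => (hO cl hcl).1.holds_translate (hM cl hcl) n, ?_, ?_⟩
      · rwa [add_comm] at hpn
      · rwa [add_comm] at hqn
    obtain ⟨p, hp, -⟩ := A.has_zero
    obtain ⟨M, hM, hA, -⟩ := hO.exists_model_of_pairwise hpair A.atoms subset_rfl hp hp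
    exact hincons ⟨M, hM, hA⟩
  · rintro ⟨p, hp, q, hq, h⟩ ⟨M, hM, hA⟩
    have hnot := leadsTo_true_false_iff.1 h M hM 0
    simp only [zero_add] at hnot
    exact hnot (hA p hp) (hA q hq)

end LTLOMQ
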